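/- Every packing P of a body K in Euclidean space ℝ^d admits as a limit some uniformly recurrent packing Q (i.e. there is a uniformly recurrent packing Q with Q ≽_L P); moreover, if P is uniformly dense then Q can be chosen to be uniformly dense as well. -/

import Mathlib

open MeasureTheory Metric Filter Pointwise
open scoped ENNReal NNReal

noncomputable section

abbrev Euc (d : ℕ) : Type := EuclideanSpace ℝ (Fin d)

/-- A body: a compact domain (compact set equal to the closure of its interior). -/
def IsBody {d : ℕ} (K : Set (Euc d)) : Prop :=
  IsCompact K ∧ K = closure (interior K)

/-- `D` is an isometric copy of `K`. -/
def IsIsomCopy {d : ℕ} (K D : Set (Euc d)) : Prop :=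
  ∃ f : Euc d ≃ᵢ Euc d, D = f '' K

def PairwiseDisjointInteriors {d : ℕ} (P : Set (Set (Euc d))) : Prop :=
  P.Pairwise fun D E => interior D ∩ interior E = ∅

/-- A packing of the body `K`: a collection of isometric copies of `K`
with pairwise disjoint interiors. -/
def IsPacking {d : ℕ} (K : Set (Euc d)) (P : Set (Set (Euc d))) : Prop :=
  (∀ D ∈ P, IsIsomCopy K D) ∧ PairwiseDisjointInteriors P

/-- Translate every element of a collection by the vector `v`. -/
def translatePacking {d : ℕ} (v : Euc d) (P : Set (Set (Euc d))) : Set (Set (Euc d)) :=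
  (fun D => (fun x => x + v) '' D) '' P

/-- The fraction of the ball `B(p,r)` covered by the collection `P`
(the sum over elements of `P` of the volume of the intersection, divided
by the volume of the ball). -/
def ballFrac {d : ℕ} (P : Set (Set (Euc d))) (p : Euc d) (r : ℝ) : ℝ :=
  ((∑' D : P, volume ((D : Set (Euc d)) ∩ ball p r)) / volume (ball p r)).toReal

/-- `P` has density `δ`. -/
def HasDensity {d : ℕ} (P : Set (Set (Euc d))) (δ : ℝ) : Prop :=
  ∀ p : Euc d, Tendsto (fun r => ballFrac P p r) atTop (nhds δ)

/-- `P` has density `δ` uniformly in the center point. -/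
def HasUniformDensity {d : ℕ} (P : Set (Set (Euc d))) (δ : ℝ) : Prop :=
  TendstoUniformly (fun r (p : Euc d) => ballFrac P p r) (fun _ => δ) atTop

/-- The packing density of the body `K`. -/
def packingDensity {d : ℕ} (K : Set (Euc d)) : ℝ :=
  sSup {δ : ℝ | ∃ P, IsPacking K P ∧ HasDensity P δ}

/-- Modified Hausdorff distance at most `ε` between two collections: there is a
relation between elements, related elements are at Hausdorff distance at most `ε`,
and every element meeting the ball `B(0,1/ε)` is related to a unique element on
the other side. -/
def PackingClose {d : ℕ} (ε : ℝ) (P Q : Set (Set (Euc d))) : Prop :=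
  ∃ R : Set (Euc d) → Set (Euc d) → Prop,
    (∀ A B, R A B → A ∈ P ∧ B ∈ Q ∧ Metric.hausdorffDist A B ≤ ε) ∧
    (∀ A ∈ P, (A ∩ ball (0 : Euc d) (1 / ε)).Nonempty → ∃! B, R A B) ∧
    (∀ B ∈ Q, (B ∩ ball (0 : Euc d) (1 / ε)).Nonempty → ∃! A, R A B)

/-- Convergence of a sequence of collections to `Q` in the modified Hausdorff topology. -/
def PackingTendsto {d : ℕ} (Ps : ℕ → Set (Set (Euc d))) (Q : Set (Set (Euc d))) : Prop :=
  ∀ ε : ℝ, 0 < ε → ∀ᶠ n in atTop, PackingClose ε (Ps n) Q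

/-- `A ≽_L B` : some sequence of translates of `B` converges to `A`. -/
def IsLimitOf {d : ℕ} (A B : Set (Set (Euc d))) : Prop :=
  ∃ v : ℕ → Euc d, PackingTendsto (fun n => translatePacking (v n) B) A

/-- A packing of `K` is uniformly recurrent if it is maximal with respect to `≽_L`
among packings of `K`. -/
def UniformlyRecurrent {d : ℕ} (K : Set (Euc d)) (A : Set (Set (Euc d))) : Prop :=
  ∀ B, IsPacking K B → IsLimitOf B A → IsLimitOf A B

/-- `P` is `n`-saturated: one cannot remove `n-1` of its elements and replace them
by `n` isometric copies of `K` so that the result is still a packing. -/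
def Saturated {d : ℕ} (K : Set (Euc d)) (n : ℕ) (P : Set (Set (Euc d))) : Prop :=
  ¬ ∃ F G : Finset (Set (Euc d)), ↑F ⊆ P ∧ F.card = n - 1 ∧ G.card = n ∧
      Disjoint (↑G : Set (Set (Euc d))) (P \ ↑F) ∧
      IsPacking K ((P \ ↑F) ∪ ↑G)

def CompletelySaturated {d : ℕ} (K : Set (Euc d)) (P : Set (Set (Euc d))) : Prop :=
  ∀ n : ℕ, 1 ≤ n → Saturated K n P

/-- `K` (strictly) self-nests: for every `ε > 0` some isometric copy of `K` lies in
the interior of `(1+ε)K`. -/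
def SelfNests {d : ℕ} (K : Set (Euc d)) : Prop :=
  ∀ ε : ℝ, 0 < ε → ∃ f : Euc d ≃ᵢ Euc d, f '' K ⊆ interior ((1 + ε) • K)

/-- A single connected replacement: `A` is obtained from `B` by replacing `k < n`
copies of `K` by `k+1` copies so that the union of the `2k+1` copies involved is
connected. -/
def ConnStep {d : ℕ} (K : Set (Euc d)) (n : ℕ) (B A : Set (Set (Euc d))) : Prop :=
  ∃ (k : ℕ) (F G : Finset (Set (Euc d))), k < n ∧ ↑F ⊆ B ∧ F.card = k ∧ G.card = k + 1 ∧
    Disjoint (↑G : Set (Set (Euc d))) (B \ ↑F) ∧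
    A = (B \ ↑F) ∪ ↑G ∧ IsPacking K A ∧
    IsConnected (⋃ D ∈ (↑F ∪ ↑G : Set (Set (Euc d))), D)

/-- `A ≽_{C,n} B` : `A` is obtained from `B` by finitely many connected replacements. -/
def ConnGE {d : ℕ} (K : Set (Euc d)) (n : ℕ) (A B : Set (Set (Euc d))) : Prop :=
  Relation.ReflTransGen (ConnStep K n) B A

/-- The density function of the convolution `μ * χ_P` evaluated at the point `p`:
`∑_{D ∈ P} μ {x | p - x ∈ D}`. -/
def diffuse {d : ℕ} (μ : Measure (Euc d)) (P : Set (Set (Euc d))) (p : Euc d) : ℝ≥0∞ :=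
  ∑' D : P, μ {x : Euc d | p - x ∈ (D : Set (Euc d))}

/-- The value of the measure `χ_P * μ` on the (Borel) set `R`. -/
def diffuseOn {d : ℕ} (μ : Measure (Euc d)) (P : Set (Set (Euc d))) (R : Set (Euc d)) : ℝ≥0∞ :=
  ∫⁻ p in R, diffuse μ P p

/-- The measure with density `(n/(n+1))^{|x|/(2n-1)}` with respect to Lebesgue measure. -/
def kupMeasure (d n : ℕ) : Measure (Euc d) :=
  volume.withDensity fun x =>
    ENNReal.ofReal (((n : ℝ) / (n + 1)) ^ (‖x‖ / (2 * (n : ℝ) - 1)))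

/-- A generic packing: a collection of bodies with pairwise disjoint interiors. -/
def IsGenPacking {d : ℕ} (P : Set (Set (Euc d))) : Prop :=
  (∀ D ∈ P, IsBody D) ∧ PairwiseDisjointInteriors P

/-- `A ≽_μ B` : `μ * χ_A ≥ μ * χ_B` everywhere. -/
def MuDom {d : ℕ} (μ : Measure (Euc d)) (A B : Set (Set (Euc d))) : Prop :=
  ∀ p : Euc d, diffuse μ B p ≤ diffuse μ A p

/-- `A ≽_D B` : `A` diffusively dominates `B`. -/
def DiffDom {d : ℕ} (A B : Set (Set (Euc d))) : Prop :=
  ∃ μ : Measure (Euc d), IsFiniteMeasure μ ∧ MuDom μ A B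

/-- `P` is weakly recurrent if it is the limit of a sequence of uniformly
recurrent packings of `K`. -/
def WeaklyRecurrent {d : ℕ} (K : Set (Euc d)) (P : Set (Set (Euc d))) : Prop :=
  ∃ Bs : ℕ → Set (Set (Euc d)),
    (∀ i, IsPacking K (Bs i) ∧ UniformlyRecurrent K (Bs i)) ∧ PackingTendsto Bs P


open Topology

namespace IsIsomCopy

variable {d : ℕ} {K A B : Set (Euc d)}

theorem isCompact (hK : IsBody K) (hA : IsIsomCopy K A) : IsCompact A := by
  obtain ⟨f, rfl⟩ := hA
  exact hK.1.image f.continuous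

theorem nonempty (hne : K.Nonempty) (hA : IsIsomCopy K A) : A.Nonempty := by
  obtain ⟨f, rfl⟩ := hA
  exact hne.image f

theorem subset_closure_interior (hK : IsBody K) (hA : IsIsomCopy K A) :
    A ⊆ closure (interior A) := by
  obtain ⟨f, rfl⟩ := hA
  have h1 := f.toHomeomorph.image_interior K
  have h2 := f.toHomeomorph.image_closure (interior K)
  rw [h1, ← hK.2] at h2
  exact h2.subset

theorem hausdorffEDist_ne_top (hK : IsBody K) (hne : K.Nonempty) (hA : IsIsomCopy K A)
    (hB : IsIsomCopy K B) : hausdorffEDist A B ≠ ⊤ :=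
  hausdorffEDist_ne_top_of_nonempty_of_bounded (hA.nonempty hne) (hB.nonempty hne)
    (hA.isCompact hK).isBounded (hB.isCompact hK).isBounded

theorem volume_eq (hA : IsIsomCopy K A) : volume A = volume K := by
  obtain ⟨f, rfl⟩ := hA
  have h := f.symm.measurePreserving_euclideanHausdorffMeasure d
  rw [EuclideanSpace.euclideanHausdorffMeasure_eq_volume] at h
  rw [← h.measure_preimage_emb f.symm.toHomeomorph.measurableEmbedding K]
  congr 1
  exact f.toEquiv.image_eq_preimage_symm K

theorem translate (v : Euc d) (hA : IsIsomCopy K A) :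
    IsIsomCopy K ((fun x => x + v) '' A) := by
  obtain ⟨f, rfl⟩ := hA
  exact ⟨f.trans (IsometryEquiv.addRight v), by rw [Set.image_image]; rfl⟩

/-- Copies with disjoint interiors are at Hausdorff distance at least the inradius. -/
theorem le_hausdorffDist (hK : IsBody K) {x : Euc d} {ρ : ℝ} (hρ : 0 < ρ)
    (hx : ball x ρ ⊆ K) (hA : IsIsomCopy K A) (hB : IsIsomCopy K B)
    (hAB : interior A ∩ interior B = ∅) : ρ ≤ hausdorffDist A B := by
  by_contra! hlt
  have hne : K.Nonempty := ⟨x, hx (mem_ball_self hρ)⟩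
  have htop := hA.hausdorffEDist_ne_top hK hne hB
  obtain ⟨f, rfl⟩ := hA
  have hball : ball (f x) ρ ⊆ f '' K := by
    rw [← f.image_ball]
    exact Set.image_mono hx
  obtain ⟨z, hzB, hz⟩ := exists_dist_lt_of_hausdorffDist_lt
    (hball (mem_ball_self hρ)) hlt htop
  obtain ⟨w, hw1, hw2⟩ := mem_closure_iff.1 (hB.subset_closure_interior hK hzB) _ isOpen_ball
    (mem_ball'.2 hz)
  have : w ∈ interior (f '' K) ∩ interior B :=
    ⟨interior_maximal hball isOpen_ball hw1, hw2⟩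
  rw [hAB] at this
  exact this

end IsIsomCopy

theorem IsBody.exists_ball_subset {d : ℕ} {K : Set (Euc d)} (hK : IsBody K)
    (hne : K.Nonempty) : ∃ (x : Euc d) (ρ : ℝ), 0 < ρ ∧ ball x ρ ⊆ K := by
  rw [hK.2, closure_nonempty_iff] at hne
  obtain ⟨x, hx⟩ := hne
  obtain ⟨ρ, hρ, h⟩ := Metric.mem_nhds_iff.1 (mem_interior_iff_mem_nhds.1 hx)
  exact ⟨x, ρ, hρ, h⟩

theorem IsPacking.exists_separation {d : ℕ} {K : Set (Euc d)} (hK : IsBody K)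
    (hne : K.Nonempty) : ∃ ρ : ℝ, 0 < ρ ∧ ∀ P, IsPacking K P → ∀ A ∈ P, ∀ B ∈ P,
      hausdorffDist A B < ρ → A = B := by
  obtain ⟨x, ρ, hρ, hx⟩ := hK.exists_ball_subset hne
  refine ⟨ρ, hρ, fun P hP A hA B hB h => ?_⟩
  by_contra hAB
  exact absurd ((hP.1 A hA).le_hausdorffDist hK hρ hx (hP.1 B hB) (hP.2 hA hB hAB)) (not_le.2 h)

section Ultralimits

variable {d : ℕ} {ι : Type*} {K : Set (Euc d)}

theorem Ultrafilter.exists_tendsto_of_eventually_norm_le (U : Ultrafilter ι) {a : ι → Euc d}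
    {R : ℝ} (ha : ∀ᶠ i in U, ‖a i‖ ≤ R) : ∃ y, Tendsto a U (𝓝 y) := by
  obtain ⟨y, -, hy⟩ := (isCompact_closedBall (0 : Euc d) R).ultrafilter_le_nhds (U.map a) (by
    rw [le_principal_iff]
    exact ha.mono fun i hi => mem_closedBall_zero_iff.2 hi)
  exact ⟨y, hy⟩

theorem Ultrafilter.exists_isometryEquiv_tendsto (U : Ultrafilter ι) {g : ι → Euc d ≃ᵢ Euc d}
    {R : ℝ} (hg : ∀ᶠ i in U, ‖g i 0‖ ≤ R) :
    ∃ f : Euc d ≃ᵢ Euc d, ∀ x, Tendsto (fun i => g i x) U (𝓝 (f x)) := by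
  have h1 (x : Euc d) : ∃ y, Tendsto (fun i => g i x) U (𝓝 y) := by
    refine U.exists_tendsto_of_eventually_norm_le (R := ‖x‖ + R) ?_
    filter_upwards [hg] with i hi
    have := norm_sub_norm_le (g i x) (g i 0)
    rw [← dist_eq_norm, (g i).dist_eq, dist_zero_right] at this
    linarith
  have h2 (x : Euc d) : ∃ y, Tendsto (fun i => (g i).symm x) U (𝓝 y) := by
    refine U.exists_tendsto_of_eventually_norm_le (R := ‖x‖ + R) ?_
    filter_upwards [hg] with i hi
    have h := (g i).dist_eq ((g i).symm x) 0
    rw [IsometryEquiv.apply_symm_apply, dist_zero_right] at h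
    rw [← h, dist_eq_norm]
    exact (norm_sub_le _ _).trans (by linarith)
  choose f hf using h1
  choose k hk using h2
  have hfi : Isometry f := Isometry.of_dist_eq fun x y =>
    tendsto_nhds_unique ((hf x).dist (hf y)) (by
      simp only [IsometryEquiv.dist_eq]; exact tendsto_const_nhds)
  have hfk (x : Euc d) : f (k x) = x := by
    refine tendsto_nhds_unique (hf (k x)) ?_
    rw [tendsto_iff_dist_tendsto_zero]
    have := (hk x).dist (tendsto_const_nhds (x := k x))
    rw [dist_self] at this
    refine this.congr fun i => ?_
    rw [← (g i).dist_eq, IsometryEquiv.apply_symm_apply, dist_comm]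
  exact ⟨IsometryEquiv.mk' f k hfk hfi, hf⟩

theorem Ultrafilter.eventually_hausdorffDist_image_le (hK : IsCompact K) (U : Ultrafilter ι)
    {g : ι → Euc d ≃ᵢ Euc d} {f : Euc d ≃ᵢ Euc d}
    (hgf : ∀ x, Tendsto (fun i => g i x) U (𝓝 (f x))) {ε : ℝ} (hε : 0 < ε) :
    ∀ᶠ i in U, hausdorffDist (g i '' K) (f '' K) ≤ ε := by
  have key : ∀ᶠ i in U, ∀ x ∈ K, dist (g i x) (f x) ≤ ε := by
    by_contra hcon
    rw [← Ultrafilter.eventually_not] at hcon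
    push Not at hcon
    have : ∀ i, ∃ x, (∃ x ∈ K, ε < dist (g i x) (f x)) → x ∈ K ∧ ε < dist (g i x) (f x) := by
      intro i
      by_cases h : ∃ x ∈ K, ε < dist (g i x) (f x)
      · obtain ⟨x, hx⟩ := h
        exact ⟨x, fun _ => hx⟩
      · exact ⟨0, fun h' => absurd h' h⟩
    choose x hx using this
    obtain ⟨y, -, hy⟩ := hK.ultrafilter_le_nhds (U.map x) (by
      rw [le_principal_iff]
      exact hcon.mono fun i hi => (hx i hi).1)
    have hy' : Tendsto x U (𝓝 y) := hy
    have hd1 := hy'.dist (tendsto_const_nhds (x := y))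
    have hd2 := (hgf y).dist (tendsto_const_nhds (x := f y))
    rw [dist_self] at hd1 hd2
    obtain ⟨i, hi, hi1, hi2⟩ := (hcon.and ((hd1.eventually_lt_const (show 0 < ε / 3 by positivity)).and
      (hd2.eventually_lt_const (show 0 < ε / 3 by positivity)))).exists
    have h1 := dist_triangle4 (g i (x i)) (g i y) (f y) (f (x i))
    rw [(g i).dist_eq, f.dist_eq, dist_comm y (x i)] at h1
    linarith [(hx i hi).2]
  filter_upwards [key] with i hi
  refine hausdorffDist_le_of_mem_dist hε.le ?_ ?_
  · rintro _ ⟨x, hx, rfl⟩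
    exact ⟨f x, ⟨x, hx, rfl⟩, hi x hx⟩
  · rintro _ ⟨x, hx, rfl⟩
    exact ⟨g i x, ⟨x, hx, rfl⟩, by rw [dist_comm]; exact hi x hx⟩

/-- Copies of a body meeting a fixed ball have a limit along every ultrafilter. -/
theorem Ultrafilter.exists_limit_of_isIsomCopy (hK : IsBody K) (U : Ultrafilter ι)
    {D : ι → Set (Euc d)} {r : ℝ}
    (hD : ∀ᶠ i in U, IsIsomCopy K (D i) ∧ (D i ∩ ball 0 r).Nonempty) :
    ∃ (g : ι → Euc d ≃ᵢ Euc d) (f : Euc d ≃ᵢ Euc d), (∀ᶠ i in U, D i = g i '' K) ∧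
      ∀ x, Tendsto (fun i => g i x) U (𝓝 (f x)) := by
  have : ∀ i, ∃ g : Euc d ≃ᵢ Euc d, IsIsomCopy K (D i) → D i = g '' K := by
    intro i
    by_cases h : IsIsomCopy K (D i)
    · exact h.imp fun g hg _ => hg
    · exact ⟨IsometryEquiv.refl _, fun h' => absurd h' h⟩
  choose g hg using this
  obtain ⟨M, hM⟩ := hK.1.isBounded.exists_norm_le
  obtain ⟨f, hf⟩ := U.exists_isometryEquiv_tendsto (g := g) (R := r + M) (by
    filter_upwards [hD] with i ⟨hi, y, hy, hyr⟩
    rw [hg i hi] at hy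
    obtain ⟨x, hx, rfl⟩ := hy
    have := norm_sub_norm_le (g i 0) (g i x)
    rw [← dist_eq_norm, (g i).dist_eq, dist_zero_left] at this
    linarith [hM x hx, mem_ball_zero_iff.1 hyr])
  exact ⟨g, f, hD.mono fun i hi => hg i hi.1, hf⟩

theorem IsPacking.finite_inter_ball (hK : IsBody K) (hne : K.Nonempty) {P : Set (Set (Euc d))}
    (hP : IsPacking K P) (r : ℝ) : {D ∈ P | (D ∩ ball 0 r).Nonempty}.Finite := by
  obtain ⟨ρ, hρ, hsep⟩ := IsPacking.exists_separation hK hne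
  by_contra hinf
  have : Infinite {D ∈ P | (D ∩ ball 0 r).Nonempty} := Set.infinite_coe_iff.2 hinf
  set U := hyperfilter {D ∈ P | (D ∩ ball 0 r).Nonempty}
  obtain ⟨g, f, hg, hf⟩ := U.exists_limit_of_isIsomCopy hK (D := Subtype.val) (r := r)
    (Eventually.of_forall fun D => ⟨hP.1 _ D.2.1, D.2.2⟩)
  have hclose : ∀ᶠ D : {D ∈ P | (D ∩ ball 0 r).Nonempty} in U, hausdorffDist D.1 (f '' K) ≤ ρ / 3 := by
    filter_upwards [hg, U.eventually_hausdorffDist_image_le hK.1 hf (show 0 < ρ / 3 by positivity)]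
      with D hD hD'
    rwa [hD]
  obtain ⟨D, hD⟩ := hclose.exists
  have hconst : ∀ᶠ E in U, E = D := by
    filter_upwards [hclose] with E hE
    refine Subtype.ext (hsep P hP _ E.2.1 _ D.2.1 ?_)
    have := hausdorffDist_triangle (u := D.1)
      ((hP.1 _ E.2.1).hausdorffEDist_ne_top hK hne ⟨f, rfl⟩)
    rw [hausdorffDist_comm (s := f '' K)] at this
    linarith
  have hcof : ∀ᶠ E in U, E ≠ D :=
    hyperfilter_le_cofinite (Set.finite_singleton D).compl_mem_cofinite
  obtain ⟨E, h1, h2⟩ := (hconst.and hcof).exists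
  exact h2 h1

end Ultralimits

section LocallyClose

variable {d : ℕ} {K : Set (Euc d)} {P Q T : Set (Set (Euc d))} {ε ε' : ℝ}

/-- Every element of either collection that meets `B(0,1/ε)` is within Hausdorff distance `ε` of
some element of the other collection. -/
def LocallyClose (ε : ℝ) (P Q : Set (Set (Euc d))) : Prop :=
  (∀ A ∈ P, (A ∩ ball 0 (1 / ε)).Nonempty → ∃ B ∈ Q, hausdorffDist A B ≤ ε) ∧
    ∀ B ∈ Q, (B ∩ ball 0 (1 / ε)).Nonempty → ∃ A ∈ P, hausdorffDist A B ≤ ε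

theorem IsIsomCopy.inter_ball_nonempty (hK : IsBody K) (hne : K.Nonempty) {A B : Set (Euc d)}
    (hA : IsIsomCopy K A) (hB : IsIsomCopy K B) {t r s : ℝ} {p : Euc d}
    (hAB : hausdorffDist A B < t) (hrs : r + t ≤ s) (h : (A ∩ ball p r).Nonempty) :
    (B ∩ ball p s).Nonempty := by
  obtain ⟨x, hxA, hx⟩ := h
  obtain ⟨y, hyB, hy⟩ := exists_dist_lt_of_hausdorffDist_lt hxA hAB
    (hA.hausdorffEDist_ne_top hK hne hB)
  refine ⟨y, hyB, ?_⟩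
  rw [mem_ball] at hx ⊢
  linarith [dist_triangle_left y p x]

theorem LocallyClose.refl (hε : 0 < ε) (P : Set (Set (Euc d))) : LocallyClose ε P P :=
  ⟨fun A hA _ => ⟨A, hA, by rw [hausdorffDist_self_zero]; exact hε.le⟩,
    fun A hA _ => ⟨A, hA, by rw [hausdorffDist_self_zero]; exact hε.le⟩⟩

theorem LocallyClose.symm (h : LocallyClose ε P Q) : LocallyClose ε Q P := by
  constructor
  · intro A hA hA'
    simpa only [hausdorffDist_comm] using h.2 A hA hA'
  · intro A hA hA'
    simpa only [hausdorffDist_comm] using h.1 A hA hA'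

theorem LocallyClose.mono (hε : 0 < ε) (hle : ε ≤ ε') (h : LocallyClose ε P Q) :
    LocallyClose ε' P Q := by
  have hball : ball (0 : Euc d) (1 / ε') ⊆ ball 0 (1 / ε) :=
    ball_subset_ball (one_div_le_one_div_of_le hε hle)
  constructor
  · intro A hA hA'
    obtain ⟨B, hB, hAB⟩ := h.1 A hA (hA'.mono (Set.inter_subset_inter_right _ hball))
    exact ⟨B, hB, hAB.trans hle⟩
  · intro B hB hB'
    obtain ⟨A, hA, hAB⟩ := h.2 B hB (hB'.mono (Set.inter_subset_inter_right _ hball))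
    exact ⟨A, hA, hAB.trans hle⟩

theorem LocallyClose.trans (hK : IsBody K) (hne : K.Nonempty) (hP : IsPacking K P)
    (hQ : IsPacking K Q) (hT : IsPacking K T) (hε : 0 < ε) (hε' : ε ≤ 1 / 2)
    (h₁ : LocallyClose ε P Q) (h₂ : LocallyClose ε Q T) : LocallyClose (2 * ε) P T := by
  have key : ∀ {P T : Set (Set (Euc d))}, IsPacking K P → IsPacking K T →
      LocallyClose ε P Q → LocallyClose ε Q T →
      ∀ A ∈ P, (A ∩ ball 0 (1 / (2 * ε))).Nonempty → ∃ B ∈ T, hausdorffDist A B ≤ 2 * ε := by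
    intro P T hP hT h₁ h₂ A hA hmeet
    have hrad : 1 / (2 * ε) + 2 * ε ≤ 1 / ε := by
      rw [div_add' _ _ _ (by positivity), div_le_div_iff₀ (by positivity) hε]
      nlinarith [mul_pos hε hε]
    obtain ⟨B, hB, hAB⟩ := h₁.1 A hA (hmeet.mono (Set.inter_subset_inter_right _
      (ball_subset_ball (by linarith))))
    obtain ⟨C, hC, hBC⟩ := h₂.1 B hB ((hP.1 A hA).inter_ball_nonempty hK hne (hQ.1 B hB)
      (show hausdorffDist A B < 2 * ε by linarith) hrad hmeet)
    refine ⟨C, hC, ?_⟩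
    have := hausdorffDist_triangle (u := C) ((hP.1 A hA).hausdorffEDist_ne_top hK hne (hQ.1 B hB))
    linarith
  exact ⟨key hP hT h₁ h₂, fun B hB hB' => by
    simpa only [hausdorffDist_comm] using key hT hP h₂.symm h₁.symm B hB hB'⟩

theorem translatePacking_translatePacking (v w : Euc d) (P : Set (Set (Euc d))) :
    translatePacking v (translatePacking w P) = translatePacking (w + v) P := by
  simp only [translatePacking, Set.image_image, add_assoc]

theorem translatePacking_zero (P : Set (Set (Euc d))) : translatePacking 0 P = P := by
  simp [translatePacking]

theorem IsPacking.translate (hP : IsPacking K P) (v : Euc d) :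
    IsPacking K (translatePacking v P) := by
  constructor
  · rintro _ ⟨D, hD, rfl⟩
    exact (hP.1 D hD).translate v
  · rintro _ ⟨D, hD, rfl⟩ _ ⟨E, hE, rfl⟩ hDE
    have hne : D ≠ E := fun h => hDE (by rw [h])
    have h (S : Set (Euc d)) : interior ((fun x => x + v) '' S) = (fun x => x + v) '' interior S :=
      ((Homeomorph.addRight v).image_interior S).symm
    simp only [h]
    rw [← Set.image_inter (add_left_injective v), hP.2 hD hE hne, Set.image_empty]

theorem LocallyClose.translate (hle : ε ≤ ε') {v : Euc d} (hv : 1 / ε' + ‖v‖ ≤ 1 / ε)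
    (h : LocallyClose ε P Q) :
    LocallyClose ε' (translatePacking v P) (translatePacking v Q) := by
  have hiso : Isometry fun x : Euc d => x + v := isometry_add_right v
  have hmeet {D : Set (Euc d)} (hD : ((fun x => x + v) '' D ∩ ball 0 (1 / ε')).Nonempty) :
      (D ∩ ball 0 (1 / ε)).Nonempty := by
    obtain ⟨_, ⟨x, hx, rfl⟩, hx'⟩ := hD
    refine ⟨x, hx, ?_⟩
    rw [mem_ball_zero_iff] at hx' ⊢
    have := norm_sub_le (x + v) v
    rw [add_sub_cancel_right] at this
    linarith
  constructor
  · rintro _ ⟨A, hA, rfl⟩ hA'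
    obtain ⟨B, hB, hAB⟩ := h.1 A hA (hmeet hA')
    exact ⟨_, ⟨B, hB, rfl⟩, by rw [hausdorffDist_image hiso]; exact hAB.trans hle⟩
  · rintro _ ⟨B, hB, rfl⟩ hB'
    obtain ⟨A, hA, hAB⟩ := h.2 B hB (hmeet hB')
    exact ⟨_, ⟨A, hA, rfl⟩, by rw [hausdorffDist_image hiso]; exact hAB.trans hle⟩

theorem PackingClose.locallyClose (h : PackingClose ε P Q) : LocallyClose ε P Q := by
  obtain ⟨R, hR, h₁, h₂⟩ := h
  constructor
  · intro A hA hA'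
    obtain ⟨B, hB, -⟩ := h₁ A hA hA'
    exact ⟨B, (hR A B hB).2⟩
  · intro B hB hB'
    obtain ⟨A, hA, -⟩ := h₂ B hB hB'
    exact ⟨A, (hR A B hA).1, (hR A B hA).2.2⟩

theorem PackingClose.mono (hε : 0 < ε) (hle : ε ≤ ε') (h : PackingClose ε P Q) :
    PackingClose ε' P Q := by
  have hball : ball (0 : Euc d) (1 / ε') ⊆ ball 0 (1 / ε) :=
    ball_subset_ball (one_div_le_one_div_of_le hε hle)
  obtain ⟨R, hR, h₁, h₂⟩ := h
  exact ⟨R, fun A B hAB => ⟨(hR A B hAB).1, (hR A B hAB).2.1, (hR A B hAB).2.2.trans hle⟩,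
    fun A hA hA' => h₁ A hA (hA'.mono (Set.inter_subset_inter_right _ hball)),
    fun B hB hB' => h₂ B hB (hB'.mono (Set.inter_subset_inter_right _ hball))⟩

theorem LocallyClose.packingClose (hK : IsBody K) (hne : K.Nonempty) (hP : IsPacking K P)
    (hQ : IsPacking K Q) {ρ : ℝ} (hsep : ∀ P, IsPacking K P → ∀ A ∈ P, ∀ B ∈ P,
      hausdorffDist A B < ρ → A = B) (hε : 2 * ε < ρ) (h : LocallyClose ε P Q) :
    PackingClose ε P Q := by
  refine ⟨fun A B => A ∈ P ∧ B ∈ Q ∧ hausdorffDist A B ≤ ε, fun A B h => h, ?_, ?_⟩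
  · intro A hA hA'
    obtain ⟨B, hB, hAB⟩ := h.1 A hA hA'
    refine ⟨B, ⟨hA, hB, hAB⟩, fun C hC => hsep Q hQ C hC.2.1 B hB ?_⟩
    have := hausdorffDist_triangle (u := B)
      ((hQ.1 C hC.2.1).hausdorffEDist_ne_top hK hne (hP.1 A hA))
    rw [hausdorffDist_comm (s := C) (t := A)] at this
    linarith [hC.2.2]
  · intro B hB hB'
    obtain ⟨A, hA, hAB⟩ := h.2 B hB hB'
    refine ⟨A, ⟨hA, hB, hAB⟩, fun C hC => hsep P hP C hC.1 A hA ?_⟩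
    have := hausdorffDist_triangle (u := A)
      ((hP.1 C hC.1).hausdorffEDist_ne_top hK hne (hQ.1 B hB))
    rw [hausdorffDist_comm (s := B) (t := A)] at this
    linarith [hC.2.2]

theorem isLimitOf_iff_locallyClose (hK : IsBody K) (hne : K.Nonempty) (hP : IsPacking K P)
    (hQ : IsPacking K Q) :
    IsLimitOf Q P ↔ ∀ ε : ℝ, 0 < ε → ∃ v, LocallyClose ε (translatePacking v P) Q := by
  constructor
  · rintro ⟨v, hv⟩ ε hε
    obtain ⟨n, hn⟩ := (hv ε hε).exists
    exact ⟨v n, hn.locallyClose⟩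
  · intro h
    obtain ⟨ρ, hρ, hsep⟩ := IsPacking.exists_separation hK hne
    choose v hv using fun n : ℕ => h (1 / ((n : ℝ) + 1)) Nat.one_div_pos_of_nat
    refine ⟨v, fun ε hε => ?_⟩
    have hlim := tendsto_one_div_add_atTop_nhds_zero_nat (𝕜 := ℝ)
    filter_upwards [hlim.eventually_lt_const hε,
      hlim.eventually_lt_const (show 0 < ρ / 2 by positivity)] with n hn hn'
    exact ((hv n).packingClose hK hne (hP.translate _) hQ hsep (by linarith)).mono
      Nat.one_div_pos_of_nat hn.le

theorem IsLimitOf.refl (hK : IsBody K) (hne : K.Nonempty) (hP : IsPacking K P) : IsLimitOf P P :=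
  (isLimitOf_iff_locallyClose hK hne hP hP).2 fun ε hε =>
    ⟨0, by rw [translatePacking_zero]; exact LocallyClose.refl hε P⟩

/-- A packing that is locally approximated by translates of limits of `P` is a limit of `P`. -/
theorem isLimitOf_of_locallyClose (hK : IsBody K) (hne : K.Nonempty) (hP : IsPacking K P)
    (hT : IsPacking K T)
    (h : ∀ ε : ℝ, 0 < ε → ∃ Q, IsPacking K Q ∧ IsLimitOf Q P ∧
      ∃ v, LocallyClose ε (translatePacking v Q) T) : IsLimitOf T P := by
  refine (isLimitOf_iff_locallyClose hK hne hP hT).2 fun ε hε => ?_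
  set δ := min (ε / 2) (1 / 2) with hδdef
  have hδ : 0 < δ := by positivity
  obtain ⟨Q, hQ, hQP, v, hv⟩ := h δ hδ
  set η := 1 / (1 / δ + ‖v‖) with hηdef
  have hη : 0 < η := by positivity
  have hηδ : η ≤ δ := by
    rw [hηdef, one_div_le (by positivity) hδ]
    linarith [norm_nonneg v]
  obtain ⟨w, hw⟩ := (isLimitOf_iff_locallyClose hK hne hP hQ).1 hQP η hη
  have hwv := hw.translate hηδ (v := v) (by rw [hηdef, one_div_one_div])
  rw [translatePacking_translatePacking] at hwv
  exact ⟨w + v, (hwv.trans hK hne (hP.translate _) (hQ.translate _) hT hδ (min_le_right _ _)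
    hv).mono (by positivity) (by linarith [min_le_left (ε / 2) (1 / 2)])⟩

theorem IsLimitOf.trans (hK : IsBody K) (hne : K.Nonempty) (hP : IsPacking K P)
    (hQ : IsPacking K Q) (hT : IsPacking K T) (h₁ : IsLimitOf T Q) (h₂ : IsLimitOf Q P) :
    IsLimitOf T P :=
  isLimitOf_of_locallyClose hK hne hP hT fun ε hε =>
    ⟨Q, hQ, h₂, (isLimitOf_iff_locallyClose hK hne hQ hT).1 h₁ ε hε⟩

end LocallyClose

/-- Compactness of the space of packings: every family of packings has a limit along every
ultrafilter. -/
theorem Ultrafilter.exists_isPacking_locallyClose {d : ℕ} {ι : Type*} {K : Set (Euc d)}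
    (hK : IsBody K) (hne : K.Nonempty) (U : Ultrafilter ι) {F : ι → Set (Set (Euc d))}
    (hF : ∀ i, IsPacking K (F i)) :
    ∃ Q, IsPacking K Q ∧ ∀ ε : ℝ, 0 < ε → ∀ᶠ i in U, LocallyClose ε (F i) Q := by
  set Q : Set (Set (Euc d)) := {B | ∃ (g : ι → Euc d ≃ᵢ Euc d) (f : Euc d ≃ᵢ Euc d), B = f '' K ∧
    (∀ᶠ i in U, g i '' K ∈ F i) ∧ ∀ x, Tendsto (fun i => g i x) U (𝓝 (f x))} with hQdef
  have hclose {g : ι → Euc d ≃ᵢ Euc d} {f : Euc d ≃ᵢ Euc d}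
      (hgf : ∀ x, Tendsto (fun i => g i x) U (𝓝 (f x))) {ε : ℝ} (hε : 0 < ε) :=
    U.eventually_hausdorffDist_image_le hK.1 hgf hε
  have hint {g : ι → Euc d ≃ᵢ Euc d} {f : Euc d ≃ᵢ Euc d}
      (hgf : ∀ x, Tendsto (fun i => g i x) U (𝓝 (f x))) {y : Euc d}
      (hy : y ∈ interior (f '' K)) : ∀ᶠ i in U, y ∈ interior (g i '' K) := by
    have himg (e : Euc d ≃ᵢ Euc d) : e '' interior K = interior (e '' K) :=
      e.toHomeomorph.image_interior K
    rw [← himg] at hy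
    obtain ⟨x, hx, rfl⟩ := hy
    have hlim : Tendsto (fun i => (g i).symm (f x)) U (𝓝 x) := by
      rw [tendsto_iff_dist_tendsto_zero]
      have := (hgf x).dist (tendsto_const_nhds (x := f x))
      rw [dist_self] at this
      refine this.congr fun i => ?_
      rw [← (g i).dist_eq ((g i).symm (f x)), IsometryEquiv.apply_symm_apply, dist_comm]
    filter_upwards [hlim.eventually (isOpen_interior.mem_nhds hx)] with i hi
    rw [← himg]
    exact ⟨_, hi, (g i).apply_symm_apply _⟩
  have hQ : IsPacking K Q := by
    refine ⟨fun B ⟨g, f, hB, _⟩ => ⟨f, hB⟩, ?_⟩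
    rintro B ⟨g, f, rfl, hg, hgf⟩ B' ⟨g', f', rfl, hg', hgf'⟩ hBB'
    rw [Set.eq_empty_iff_forall_notMem]
    rintro y ⟨hy, hy'⟩
    have heq : ∀ᶠ i in U, g i '' K = g' i '' K := by
      filter_upwards [hg, hg', hint hgf hy, hint hgf' hy'] with i h₁ h₂ h₃ h₄
      by_contra hcon
      have : y ∈ interior (g i '' K) ∩ interior (g' i '' K) := ⟨h₃, h₄⟩
      rw [(hF i).2 h₁ h₂ hcon] at this
      exact this
    have hcopy (e : Euc d ≃ᵢ Euc d) : IsIsomCopy K (e '' K) := ⟨e, rfl⟩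
    refine hBB' (((hcopy f).isCompact hK).isClosed.hausdorffDist_zero_iff_eq
      ((hcopy f').isCompact hK).isClosed ((hcopy f).hausdorffEDist_ne_top hK hne (hcopy f')) |>.1
      (le_antisymm (le_of_forall_pos_le_add fun ε hε => ?_) hausdorffDist_nonneg))
    obtain ⟨i, hi, h₁, h₂⟩ := (heq.and ((hclose hgf (half_pos hε)).and
      (hclose hgf' (half_pos hε)))).exists
    have := hausdorffDist_triangle (u := f' '' K)
      ((hcopy f).hausdorffEDist_ne_top hK hne (hcopy (g i)))
    rw [hausdorffDist_comm (s := f '' K) (t := g i '' K)] at this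
    rw [← hi] at h₂
    linarith
  refine ⟨Q, hQ, fun ε hε => Eventually.and ?_ ?_⟩
  · by_contra hcon
    rw [← Ultrafilter.eventually_not] at hcon
    push Not at hcon
    have : ∀ i, ∃ A, (∃ A ∈ F i, (A ∩ ball 0 (1 / ε)).Nonempty ∧
        ∀ B ∈ Q, ε < hausdorffDist A B) → A ∈ F i ∧ (A ∩ ball 0 (1 / ε)).Nonempty ∧
        ∀ B ∈ Q, ε < hausdorffDist A B := by
      intro i
      by_cases h : ∃ A ∈ F i, (A ∩ ball 0 (1 / ε)).Nonempty ∧ ∀ B ∈ Q, ε < hausdorffDist A B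
      · exact h.imp fun A hA _ => hA
      · exact ⟨∅, fun h' => absurd h' h⟩
    choose A hA using this
    obtain ⟨g, f, hg, hgf⟩ := U.exists_limit_of_isIsomCopy hK (D := A) (r := 1 / ε)
      (hcon.mono fun i hi => ⟨(hF i).1 _ (hA i hi).1, (hA i hi).2.1⟩)
    have hfQ : f '' K ∈ Q := by
      refine ⟨g, f, rfl, ?_, hgf⟩
      filter_upwards [hg, hcon] with i h₁ h₂
      rw [← h₁]
      exact (hA i h₂).1
    obtain ⟨i, h₁, h₂, h₃⟩ := (hg.and (hcon.and (hclose hgf hε))).exists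
    have := (hA i h₂).2.2 _ hfQ
    rw [h₁] at this
    exact absurd h₃ (not_le.2 this)
  · have hfin := (eventually_all_finite (hQ.finite_inter_ball hK hne (1 / ε)) (l := (U : Filter ι))
      (p := fun B i => ∃ A ∈ F i, hausdorffDist A B ≤ ε)).2 (by
        rintro B ⟨⟨g, f, rfl, hg, hgf⟩, -⟩
        filter_upwards [hg, hclose hgf hε] with i h₁ h₂
        exact ⟨_, h₁, h₂⟩)
    exact hfin.mono fun i hi B hB hB' => hi B ⟨hB, hB'⟩

theorem IsPacking.exists_uniformlyRecurrent_isLimitOf {d : ℕ} {K : Set (Euc d)} (hK : IsBody K)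
    (hne : K.Nonempty) {P : Set (Set (Euc d))} (hP : IsPacking K P) :
    ∃ Q, IsPacking K Q ∧ UniformlyRecurrent K Q ∧ IsLimitOf Q P := by
  have htrans {A B C : {Q // IsPacking K Q ∧ IsLimitOf Q P}} (h₁ : IsLimitOf B.1 A.1)
      (h₂ : IsLimitOf C.1 B.1) : IsLimitOf C.1 A.1 :=
    h₂.trans hK hne A.2.1 B.2.1 C.2.1 h₁
  obtain ⟨Q, hQ⟩ := exists_maximal_of_chains_bounded
    (α := {Q // IsPacking K Q ∧ IsLimitOf Q P}) (r := fun A B => IsLimitOf B.1 A.1) (by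
      intro c hc
      rcases c.eq_empty_or_nonempty with rfl | hcne
      · exact ⟨⟨P, hP, IsLimitOf.refl hK hne hP⟩, by simp⟩
      have : Nonempty c := hcne.to_subtype
      set tails : Filter c := ⨅ a : c, 𝓟 {b : c | IsLimitOf b.1.1 a.1.1}
      have hrefl (a : c) : IsLimitOf a.1.1 a.1.1 := IsLimitOf.refl hK hne a.1.2.1
      have hneBot : tails.NeBot := by
        refine iInf_neBot_of_directed ?_ fun a => principal_neBot_iff.2 ⟨a, hrefl a⟩
        intro a b
        rcases eq_or_ne a b with rfl | hab
        · exact ⟨a, le_rfl, le_rfl⟩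
        rcases hc a.2 b.2 (fun h => hab (Subtype.ext h)) with h | h
        · exact ⟨b, principal_mono.2 fun x hx => htrans h hx, le_rfl⟩
        · exact ⟨a, le_rfl, principal_mono.2 fun x hx => htrans h hx⟩
      obtain ⟨T, hT, hlim⟩ := (Ultrafilter.of tails).exists_isPacking_locallyClose hK hne
        (F := fun a : c => a.1.1) fun a => a.1.2.1
      have hub (a : c) : IsLimitOf T a.1.1 := by
        refine isLimitOf_of_locallyClose hK hne a.1.2.1 hT fun ε hε => ?_
        have hmem : {b : c | IsLimitOf b.1.1 a.1.1} ∈ Ultrafilter.of tails :=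
          Ultrafilter.of_le tails (mem_iInf_of_mem a (mem_principal_self _))
        obtain ⟨b, hb, hb'⟩ := ((hlim ε hε).and hmem).exists
        exact ⟨b.1.1, b.1.2.1, hb', 0, by rwa [translatePacking_zero]⟩
      obtain ⟨a⟩ := this
      exact ⟨⟨T, hT, (hub a).trans hK hne hP a.1.2.1 hT a.1.2.2⟩, fun b hb => hub ⟨b, hb⟩⟩)
    htrans
  exact ⟨Q.1, Q.2.1, fun B hB hBQ =>
    hQ ⟨B, hB, hBQ.trans hK hne hP Q.2.1 hB Q.2.2⟩ hBQ, Q.2.2⟩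

section Density

variable {d : ℕ} {K : Set (Euc d)} {P Q : Set (Set (Euc d))}

/-- The total volume of the elements of a collection inside a ball. -/
def coveredVolume (P : Set (Set (Euc d))) (p : Euc d) (r : ℝ) : ℝ≥0∞ :=
  ∑' D : P, volume ((D : Set (Euc d)) ∩ ball p r)

theorem coveredVolume_eq_tsum_inter (P : Set (Set (Euc d))) (p : Euc d) (r : ℝ) :
    coveredVolume P p r = ∑' D : {D ∈ P | (D ∩ ball p r).Nonempty}, volume (D.1 ∩ ball p r) := by
  rw [coveredVolume, tsum_subtype P (fun D => volume (D ∩ ball p r)),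
    tsum_subtype {D ∈ P | (D ∩ ball p r).Nonempty} (fun D => volume (D ∩ ball p r))]
  refine tsum_congr fun D => ?_
  by_cases hD : D ∈ P
  · rw [Set.indicator_of_mem hD]
    by_cases h : (D ∩ ball p r).Nonempty
    · rw [Set.indicator_of_mem (show D ∈ {D ∈ P | (D ∩ ball p r).Nonempty} from ⟨hD, h⟩)]
    · rw [Set.indicator_of_notMem (fun h' => h h'.2), Set.not_nonempty_iff_eq_empty.1 h,
        measure_empty]
  · rw [Set.indicator_of_notMem hD, Set.indicator_of_notMem (fun h' => hD h'.1)]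

theorem IsPacking.coveredVolume_ne_top (hK : IsBody K) (hne : K.Nonempty) (hP : IsPacking K P)
    (p : Euc d) (r : ℝ) : coveredVolume P p r ≠ ⊤ := by
  have hsub : {D ∈ P | (D ∩ ball p r).Nonempty} ⊆ {D ∈ P | (D ∩ ball 0 (r + ‖p‖)).Nonempty} :=
    fun D hD => ⟨hD.1, hD.2.mono (Set.inter_subset_inter_right _
      (ball_subset_ball' (by rw [dist_zero_right])))⟩
  have := ((hP.finite_inter_ball hK hne (r + ‖p‖)).subset hsub).fintype
  rw [coveredVolume_eq_tsum_inter, tsum_fintype]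
  exact ENNReal.sum_ne_top.2 fun D _ =>
    ((measure_mono Set.inter_subset_right).trans_lt measure_ball_lt_top).ne

theorem coveredVolume_translatePacking (v : Euc d) (P : Set (Set (Euc d))) (p : Euc d) (r : ℝ) :
    coveredVolume (translatePacking v P) p r = coveredVolume P (p - v) r := by
  rw [coveredVolume, translatePacking, tsum_image (fun D => volume (D ∩ ball p r))
    (Set.image_injective.2 (add_left_injective v)).injOn]
  refine tsum_congr fun D => ?_
  rw [← measure_preimage_add_right volume v, Set.preimage_inter,
    Set.preimage_image_eq _ (add_left_injective v), preimage_add_right_ball]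

theorem IsPacking.exists_coveredVolume_le (hK : IsBody K) (hne : K.Nonempty) :
    ∃ c : ℝ, 0 < c ∧ ∃ ε₀ : ℝ, 0 < ε₀ ∧ ∀ P Q, IsPacking K P → IsPacking K Q →
      ∀ (p : Euc d) (r : ℝ), (∀ A ∈ P, (A ∩ ball p r).Nonempty →
        ∃ B ∈ Q, hausdorffDist A B ≤ ε₀) → coveredVolume P p r ≤ coveredVolume Q p (r + c) := by
  obtain ⟨ρ, hρ, hsep⟩ := IsPacking.exists_separation hK hne
  have hdiam {B : Set (Euc d)} (hB : IsIsomCopy K B) : diam B = diam K := by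
    obtain ⟨f, rfl⟩ := hB
    exact f.isometry.diam_image K
  refine ⟨ρ + diam K, add_pos_of_pos_of_nonneg hρ diam_nonneg, ρ / 3, by positivity,
    fun P Q hP hQ p r h => ?_⟩
  choose! B hB using h
  rw [coveredVolume_eq_tsum_inter]
  have hle : ∀ D : {D ∈ P | (D ∩ ball p r).Nonempty},
      volume (D.1 ∩ ball p r) ≤ volume (B D.1 ∩ ball p (r + (ρ + diam K))) := by
    rintro ⟨D, hD, hmeet⟩
    obtain ⟨hBQ, hBD⟩ := hB D hD hmeet
    have hsub : B D ⊆ ball p (r + (ρ + diam K)) := by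
      intro y hy
      obtain ⟨z, hz, hzp⟩ := (hP.1 D hD).inter_ball_nonempty hK hne (hQ.1 _ hBQ)
        (show hausdorffDist D (B D) < ρ by linarith) le_rfl hmeet
      have h₁ := dist_le_diam_of_mem ((hQ.1 _ hBQ).isCompact hK).isBounded hy hz
      rw [hdiam (hQ.1 _ hBQ)] at h₁
      rw [mem_ball] at hzp ⊢
      linarith [dist_triangle y z p]
    calc volume (D ∩ ball p r) ≤ volume D := measure_mono Set.inter_subset_left
      _ = volume (B D) := by rw [(hP.1 D hD).volume_eq, (hQ.1 _ hBQ).volume_eq]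
      _ = _ := by rw [Set.inter_eq_left.2 hsub]
  let φ : {D ∈ P | (D ∩ ball p r).Nonempty} → Q := fun D => ⟨B D.1, (hB D.1 D.2.1 D.2.2).1⟩
  have hφ : Function.Injective φ := by
    intro D E hDE
    have hDE' : B D.1 = B E.1 := congrArg Subtype.val hDE
    obtain ⟨hD₁, hD₂⟩ := hB D.1 D.2.1 D.2.2
    obtain ⟨hE₁, hE₂⟩ := hB E.1 E.2.1 E.2.2
    refine Subtype.ext (hsep P hP _ D.2.1 _ E.2.1 ?_)
    have := hausdorffDist_triangle (u := E.1)
      ((hP.1 _ D.2.1).hausdorffEDist_ne_top hK hne (hQ.1 _ hD₁))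
    rw [hDE', hausdorffDist_comm (s := B E.1), ← hDE'] at this
    rw [← hDE'] at hE₂
    linarith
  exact (ENNReal.tsum_le_tsum hle).trans
    (ENNReal.tsum_comp_le_tsum_of_injective hφ fun D : Q => volume (D.1 ∩ ball p (r + _)))

theorem ballFrac_le_of_coveredVolume_le {p q : Euc d} {r s : ℝ} (hr : 0 < r) (hs : 0 < s)
    (hQ : coveredVolume Q q s ≠ ⊤) (h : coveredVolume P p r ≤ coveredVolume Q q s) :
    ballFrac P p r ≤ ballFrac Q q s * (s / r) ^ d := by
  have hvol (x : Euc d) {t : ℝ} (ht : 0 < t) :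
      (volume (ball x t)).toReal = t ^ d * (volume (ball (0 : Euc d) 1)).toReal := by
    rw [Measure.addHaar_ball_of_pos volume x ht, finrank_euclideanSpace_fin, ENNReal.toReal_mul,
      ENNReal.toReal_ofReal (by positivity)]
  have hω : 0 < (volume (ball (0 : Euc d) 1)).toReal :=
    ENNReal.toReal_pos (measure_ball_pos volume _ one_pos).ne' measure_ball_lt_top.ne
  change (coveredVolume P p r / _).toReal ≤ (coveredVolume Q q s / _).toReal * _
  rw [ENNReal.toReal_div, ENNReal.toReal_div, hvol p hr, hvol q hs]
  have hle := ENNReal.toReal_mono hQ h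
  have heq : (coveredVolume Q q s).toReal / (s ^ d * (volume (ball (0 : Euc d) 1)).toReal) *
      (s / r) ^ d =
      (coveredVolume Q q s).toReal / (r ^ d * (volume (ball (0 : Euc d) 1)).toReal) := by
    rw [div_pow]
    field_simp
  rw [heq]
  gcongr

/-- Limits inherit uniform densities. -/
theorem HasUniformDensity.of_isLimitOf (hK : IsBody K) (hne : K.Nonempty) (hP : IsPacking K P)
    (hQ : IsPacking K Q) (hQP : IsLimitOf Q P) {δ : ℝ} (h : HasUniformDensity P δ) :
    HasUniformDensity Q δ := by
  obtain ⟨c, hc, ε₀, hε₀, hvol⟩ := IsPacking.exists_coveredVolume_le hK hne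
  have hcover (p : Euc d) {r : ℝ} (hr : 0 < r) : ∃ v : Euc d,
      coveredVolume Q p r ≤ coveredVolume P (p - v) (r + c) ∧
      coveredVolume P (p - v) (r - c) ≤ coveredVolume Q p r := by
    have hpos : 0 < r + ‖p‖ := by positivity
    obtain ⟨v, hv⟩ := (isLimitOf_iff_locallyClose hK hne hP hQ).1 hQP
      (min ε₀ (1 / (r + ‖p‖))) (by positivity)
    have hball : ball p r ⊆ ball 0 (1 / min ε₀ (1 / (r + ‖p‖))) := by
      refine (ball_subset_ball' (ε₂ := r + ‖p‖) (by rw [dist_zero_right])).trans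
        (ball_subset_ball ?_)
      rw [le_one_div hpos (by positivity)]
      exact min_le_right _ _
    refine ⟨v, ?_, ?_⟩
    · rw [← coveredVolume_translatePacking]
      refine hvol _ _ hQ (hP.translate v) p r fun A hA hA' => ?_
      obtain ⟨B, hB, hAB⟩ := hv.symm.1 A hA (hA'.mono (Set.inter_subset_inter_right _ hball))
      exact ⟨B, hB, hAB.trans (min_le_left _ _)⟩
    · rw [← coveredVolume_translatePacking]
      have := hvol _ _ (hP.translate v) hQ p (r - c) fun A hA hA' => by
        obtain ⟨B, hB, hAB⟩ := hv.1 A hA (hA'.mono (Set.inter_subset_inter_right _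
          ((ball_subset_ball (by linarith)).trans hball)))
        exact ⟨B, hB, hAB.trans (min_le_left _ _)⟩
      rwa [sub_add_cancel] at this
  rw [HasUniformDensity, Metric.tendstoUniformly_iff] at h ⊢
  intro η hη
  have hcr : Tendsto (fun r : ℝ => c / r) atTop (𝓝 0) := tendsto_const_nhds.div_atTop tendsto_id
  have hup : Tendsto (fun r : ℝ => (δ + η / 2) * (1 + c / r) ^ d) atTop (𝓝 (δ + η / 2)) := by
    simpa using ((hcr.const_add 1).pow d).const_mul (δ + η / 2)
  have hlow : Tendsto (fun r : ℝ => (δ - η / 2) * (1 - c / r) ^ d) atTop (𝓝 (δ - η / 2)) := by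
    simpa using ((hcr.const_sub 1).pow d).const_mul (δ - η / 2)
  filter_upwards [hup.eventually_lt_const (show δ + η / 2 < δ + η by linarith),
    hlow.eventually_const_lt (show δ - η < δ - η / 2 by linarith),
    (tendsto_atTop_add_const_right atTop c tendsto_id).eventually (h (η / 2) (half_pos hη)),
    (tendsto_atTop_add_const_right atTop (-c) tendsto_id).eventually (h (η / 2) (half_pos hη)),
    eventually_gt_atTop c] with r h₁ h₂ h₃ h₄ hrc p
  have hr : 0 < r := hc.trans hrc
  obtain ⟨v, hv₁, hv₂⟩ := hcover p hr
  have h₃' := abs_lt.1 (h₃ (p - v))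
  have h₄' := abs_lt.1 (h₄ (p - v))
  simp only [id_eq, ← sub_eq_add_neg] at h₃' h₄'
  have hrat₁ : (r + c) / r = 1 + c / r := by field_simp
  have hrat₂ : (r - c) / r = 1 - c / r := by field_simp
  have hrat₃ : 0 < 1 - c / r := by rw [← hrat₂]; exact div_pos (by linarith) hr
  have hU := ballFrac_le_of_coveredVolume_le hr (by linarith)
    (hP.coveredVolume_ne_top hK hne _ _) hv₁
  have hL := ballFrac_le_of_coveredVolume_le (by linarith) hr
    (hQ.coveredVolume_ne_top hK hne _ _) hv₂
  rw [hrat₁] at hU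
  have hL' : ballFrac P (p - v) (r - c) * (1 - c / r) ^ d ≤ ballFrac Q p r := by
    rw [← hrat₂]
    calc _ ≤ ballFrac Q p r * (r / (r - c)) ^ d * ((r - c) / r) ^ d := by
          gcongr
      _ = ballFrac Q p r := by
          have : r - c ≠ 0 := by linarith
          rw [mul_assoc, ← mul_pow, div_mul_div_cancel₀ this, div_self hr.ne', one_pow, mul_one]
  have hU' : ballFrac P (p - v) (r + c) * (1 + c / r) ^ d ≤ (δ + η / 2) * (1 + c / r) ^ d := by
    gcongr
    linarith
  have hL'' : (δ - η / 2) * (1 - c / r) ^ d ≤ ballFrac P (p - v) (r - c) * (1 - c / r) ^ d := by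
    gcongr
    linarith
  rw [Real.dist_eq, abs_lt]
  constructor <;> linarith

end Density

theorem isLimitOf_of_isPacking_empty {d : ℕ} {P Q : Set (Set (Euc d))}
    (hP : IsPacking ∅ P) (hQ : IsPacking ∅ Q) : IsLimitOf Q P := by
  have hempty {T : Set (Set (Euc d))} (hT : IsPacking ∅ T) {D : Set (Euc d)} (hD : D ∈ T) :
      D = ∅ := by
    obtain ⟨f, hf⟩ := hT.1 D hD
    rw [hf, Set.image_empty]
  refine ⟨0, fun ε hε => Eventually.of_forall fun n => ⟨fun _ _ => False, by simp, ?_, ?_⟩⟩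
  · rintro A hA ⟨x, hx, -⟩
    rw [hempty (hP.translate _) hA] at hx
    exact hx.elim
  · rintro B hB ⟨x, hx, -⟩
    rw [hempty hQ hB] at hx
    exact hx.elim

/-- Every packing `P` of a body `K` in `ℝ^d` admits a uniformly
recurrent packing `Q` as a limit; if `P` is uniformly dense, `Q` can be chosen
uniformly dense as well. -/
theorem every_packing_has_uniformly_recurrent_limit {d : ℕ} (K : Set (Euc d))
    (hK : IsBody K) (P : Set (Set (Euc d))) (hP : IsPacking K P) :
    ∃ Q : Set (Set (Euc d)), IsPacking K Q ∧ UniformlyRecurrent K Q ∧ IsLimitOf Q P ∧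
      (HasUniformDensity P (packingDensity K) → HasUniformDensity Q (packingDensity K)) := by
  rcases K.eq_empty_or_nonempty with rfl | hne
  · exact ⟨P, hP, fun B hB _ => isLimitOf_of_isPacking_empty hB hP,
      isLimitOf_of_isPacking_empty hP hP, id⟩
  · obtain ⟨Q, hQ, hrec, hlim⟩ := hP.exists_uniformlyRecurrent_isLimitOf hK hne
    exact ⟨Q, hQ, hrec, hlim, fun h => h.of_isLimitOf hK hne hP hQ hlim⟩
end
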